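/- arXiv:1205.3632 — 2 statements merged into one kernel-verified Lean document; each statement's English description precedes it below -/
import Mathlib

section
/- For every Borel set K ⊆ [0,1] with dim_H(K) < min{s(p_0(y)) : y ∈ [α, β]} / log 2, one has μ_f(K) = 0. -/
open MeasureTheory Filter Set Matrix

noncomputable def Phi (a b c d z : ℝ) : ℝ := (a * z + b) / (c * z + d)

noncomputable def PhiM (M : Matrix (Fin 2) (Fin 2) ℝ) (z : ℝ) : ℝ :=
  (M 0 0 * z + M 0 1) / (M 1 0 * z + M 1 1)

noncomputable def entS (p : ℝ) : ℝ := -(p * Real.log p) - (1 - p) * Real.log (1 - p)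

noncomputable def Xdig (x : ℝ) (n : ℕ) : ℕ :=
  ⌊(2 : ℝ) ^ n * x⌋₊ - 2 * ⌊(2 : ℝ) ^ (n - 1) * x⌋₊

noncomputable def dyadI (x : ℝ) (n : ℕ) : Set ℝ :=
  Set.Ico ((⌊(2 : ℝ) ^ n * x⌋₊ : ℝ) / 2 ^ n) (((⌊(2 : ℝ) ^ n * x⌋₊ : ℝ) + 1) / 2 ^ n)

noncomputable def matProd (A : ℕ → Matrix (Fin 2) (Fin 2) ℝ) (x : ℝ) (n : ℕ) :
    Matrix (Fin 2) (Fin 2) ℝ :=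
  ((List.range n).map (fun j => A (Xdig x (j + 1)))).prod

noncomputable def Fcal (n : ℕ) : MeasurableSpace ℝ :=
  ⨆ i ∈ Finset.Icc 1 n, MeasurableSpace.comap (fun x : ℝ => Xdig x i) ⊤

noncomputable def Rfun (μf : Measure ℝ) (x : ℝ) (n : ℕ) : ℝ :=
  if n = 0 then 1 else (μf (dyadI x n)).toReal

theorem exp_neg_le_quadratic {z : ℝ} (hz : 0 ≤ z) : Real.exp (-z) ≤ 1 - z + z ^ 2 / 2 := by
  have h := Real.quadratic_le_exp_of_nonneg hz
  rw [Real.exp_neg, inv_le_iff_one_le_mul₀ (Real.exp_pos z)]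
  have h0 : 0 ≤ 1 - z + z ^ 2 / 2 := by nlinarith [sq_nonneg (z - 1)]
  nlinarith [mul_le_mul_of_nonneg_left h h0, sq_nonneg (z ^ 2)]

theorem sq_le_exp {x : ℝ} (hx : 0 ≤ x) : x ^ 2 ≤ Real.exp x := by
  have h := Real.quadratic_le_exp_of_nonneg (x := x / 2) (by linarith)
  have h1 : x ≤ Real.exp (x / 2) := by nlinarith [sq_nonneg (x - 2)]
  calc x ^ 2 ≤ Real.exp (x / 2) ^ 2 := by gcongr
    _ = Real.exp x := by rw [← Real.exp_nat_mul]; congr 1; push_cast; ring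

theorem rpow_one_add_le {p θ : ℝ} (hp : 0 < p) (hp1 : p ≤ 1) (hθ : 0 ≤ θ) :
    p ^ (1 + θ) ≤ p + θ * (p * Real.log p) + θ ^ 2 / 2 := by
  have hl : Real.log p ≤ 0 := Real.log_nonpos hp.le hp1
  have h1 := exp_neg_le_quadratic (z := -(θ * Real.log p)) (by nlinarith)
  have h2 := sq_le_exp (x := -Real.log p) (by linarith)
  rw [Real.exp_neg, Real.exp_log hp] at h2
  have h3 : p * Real.log p ^ 2 ≤ 1 := by
    have := mul_le_mul_of_nonneg_left h2 hp.le
    rw [mul_inv_cancel₀ hp.ne'] at this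
    linarith
  rw [Real.rpow_add hp, Real.rpow_one, Real.rpow_def_of_pos hp]
  rw [neg_neg, mul_comm θ] at h1
  calc p * Real.exp (Real.log p * θ)
      ≤ p * (1 - -(Real.log p * θ) + (-(Real.log p * θ)) ^ 2 / 2) := by gcongr
    _ = p + θ * (p * Real.log p) + θ ^ 2 / 2 * (p * Real.log p ^ 2) := by ring
    _ ≤ p + θ * (p * Real.log p) + θ ^ 2 / 2 := by
      nlinarith [mul_le_mul_of_nonneg_left h3 (by positivity : 0 ≤ θ ^ 2 / 2)]

theorem entS_nonneg {p : ℝ} (hp : 0 ≤ p) (hp1 : p ≤ 1) : 0 ≤ entS p := by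
  have h1 := Real.negMulLog_nonneg hp hp1
  have h2 := Real.negMulLog_nonneg (x := 1 - p) (by linarith) (by linarith)
  simp only [Real.negMulLog] at h1 h2
  unfold entS
  linarith

theorem rpow_one_add_add_rpow_one_add_le {p θ c : ℝ} (hp : 0 < p) (hp1 : p < 1) (hθ : 0 ≤ θ)
    (hc : c ≤ entS p) :
    p ^ (1 + θ) + (1 - p) ^ (1 + θ) ≤ Real.exp (-(θ * (c - θ))) := by
  have h1 := rpow_one_add_le hp hp1.le hθ
  have h2 := rpow_one_add_le (p := 1 - p) (by linarith) (by linarith) hθ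
  have h3 := Real.add_one_le_exp (-(θ * (c - θ)))
  have h4 := mul_le_mul_of_nonneg_left hc hθ
  unfold entS at h4
  nlinarith

theorem sum_range_two_mul {M : Type*} [AddCommMonoid M] (g : ℕ → M) (m : ℕ) :
    ∑ k ∈ Finset.range (2 * m), g k = ∑ k ∈ Finset.range m, (g (2 * k) + g (2 * k + 1)) := by
  induction m with
  | zero => simp
  | succ m ih =>
    rw [Finset.sum_range_succ, ← ih, show 2 * (m + 1) = 2 * m + 1 + 1 by ring,
      Finset.sum_range_succ, Finset.sum_range_succ, add_assoc]

/-- The increment of `f` over the `k`-th dyadic interval of generation `n`. -/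
noncomputable def dyadInc (f : ℝ → ℝ) (n k : ℕ) : ℝ :=
  f ((k + 1) / 2 ^ n) - f (k / 2 ^ n)

theorem dyadInc_add (f : ℝ → ℝ) (n k : ℕ) :
    dyadInc f (n + 1) (2 * k) + dyadInc f (n + 1) (2 * k + 1) = dyadInc f n k := by
  unfold dyadInc
  have h1 : ((2 * k + 1 : ℕ) + 1 : ℝ) / 2 ^ (n + 1) = (k + 1) / 2 ^ n := by
    push_cast; field_simp; ring
  have h2 : ((2 * k : ℕ) : ℝ) / 2 ^ (n + 1) = k / 2 ^ n := by
    push_cast; field_simp; ring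
  rw [h1, h2]
  push_cast
  ring

/-- If every dyadic increment splits in proportions whose entropy is at least `c`, then the
moment sums of the increments decay exponentially. -/
theorem sum_dyadInc_rpow_le {f : ℝ → ℝ} {c θ : ℝ} (hθ : 0 ≤ θ) (h01 : dyadInc f 0 0 = 1)
    (hpos : ∀ n k, k < 2 ^ n → 0 ≤ dyadInc f n k)
    (hsplit : ∀ n k, k < 2 ^ n → ∃ p, 0 < p ∧ p < 1 ∧ c ≤ entS p ∧
      dyadInc f (n + 1) (2 * k) = p * dyadInc f n k) (n : ℕ) :
    ∑ k ∈ Finset.range (2 ^ n), dyadInc f n k ^ (1 + θ) ≤ Real.exp (-(θ * (c - θ)) * n) := by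
  induction n with
  | zero => simp [h01]
  | succ n ih =>
    rw [pow_succ', sum_range_two_mul]
    calc ∑ k ∈ Finset.range (2 ^ n), (dyadInc f (n + 1) (2 * k) ^ (1 + θ)
            + dyadInc f (n + 1) (2 * k + 1) ^ (1 + θ))
        ≤ ∑ k ∈ Finset.range (2 ^ n), Real.exp (-(θ * (c - θ))) * dyadInc f n k ^ (1 + θ) := by
          refine Finset.sum_le_sum fun k hk => ?_
          have hk := Finset.mem_range.1 hk
          obtain ⟨p, hp, hp1, hc, hs⟩ := hsplit n k hk
          have hs' : dyadInc f (n + 1) (2 * k + 1) = (1 - p) * dyadInc f n k := by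
            linarith [dyadInc_add f n k]
          rw [hs, hs', Real.mul_rpow hp.le (hpos n k hk),
            Real.mul_rpow (by linarith) (hpos n k hk), ← add_mul]
          exact mul_le_mul_of_nonneg_right (rpow_one_add_add_rpow_one_add_le hp hp1 hθ hc)
            (Real.rpow_nonneg (hpos n k hk) _)
      _ ≤ Real.exp (-(θ * (c - θ))) * Real.exp (-(θ * (c - θ)) * n) := by
          rw [← Finset.mul_sum]; gcongr
      _ = Real.exp (-(θ * (c - θ)) * (n + 1 : ℕ)) := by
          rw [← Real.exp_add]; congr 1; push_cast; ring

/-- Covering a set of diameter at most `2⁻ⁿ` by three dyadic intervals of generation `n`. -/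
theorem restrict_le_of_ediam_le {μ : Measure ℝ} {G U : Set ℝ} (hG : MeasurableSet G) {n : ℕ}
    {b : ENNReal}
    (h : ∀ k : ℤ, μ (G ∩ Ioc ((k : ℝ) / 2 ^ n) ((k + 1) / 2 ^ n)) ≤ b)
    (hU : Metric.ediam U ≤ ENNReal.ofReal ((1 / 2) ^ n)) :
    μ.restrict G U ≤ 3 * b := by
  rcases U.eq_empty_or_nonempty with rfl | ⟨x₀, hx₀⟩
  · simp
  have h2 : (0 : ℝ) < 2 ^ n := by positivity
  set m : ℤ := ⌈2 ^ n * x₀⌉ with hm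
  have hm1 : 2 ^ n * x₀ ≤ m := Int.le_ceil _
  have hm2 : (m : ℝ) < 2 ^ n * x₀ + 1 := Int.ceil_lt_add_one _
  let J : ℤ → Set ℝ := fun k => G ∩ Ioc ((k : ℝ) / 2 ^ n) ((k + 1) / 2 ^ n)
  have hcov : U ∩ G ⊆ (J (m - 2) ∪ J (m - 1)) ∪ J m := by
    rintro x ⟨hxU, hxG⟩
    have hd : edist x x₀ ≤ ENNReal.ofReal ((1 / 2) ^ n) :=
      (Metric.edist_le_ediam_of_mem hxU hx₀).trans hU
    rw [edist_dist, ENNReal.ofReal_le_ofReal_iff (by positivity), Real.dist_eq, abs_le] at hd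
    have hn : (2 : ℝ) ^ n * (1 / 2) ^ n = 1 := by rw [← mul_pow]; norm_num
    have hx1 : 2 ^ n * x ≤ 2 ^ n * x₀ + 1 := by nlinarith
    have hx2 : 2 ^ n * x₀ - 1 ≤ 2 ^ n * x := by nlinarith
    simp only [J, mem_union, mem_inter_iff, mem_Ioc, hxG, true_and, div_lt_iff₀ h2,
      le_div_iff₀ h2, mul_comm x]
    push_cast
    by_cases h1 : 2 ^ n * x ≤ m - 1
    · left; left; constructor <;> linarith
    by_cases h3 : 2 ^ n * x ≤ m
    · left; right; constructor <;> linarith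
    · right; constructor <;> linarith
  calc μ.restrict G U = μ (U ∩ G) := Measure.restrict_apply' hG
    _ ≤ μ ((J (m - 2) ∪ J (m - 1)) ∪ J m) := measure_mono hcov
    _ ≤ (b + b) + b := (measure_union_le _ _).trans (add_le_add ((measure_union_le _ _).trans
        (add_le_add (h _) (h _))) (h _))
    _ = 3 * b := by ring

/-- Mass distribution principle along dyadic intervals. -/
theorem restrict_apply_eq_zero_of_hausdorffMeasure {μ : Measure ℝ} {G K : Set ℝ}
    (hG : MeasurableSet G) {s : ℝ} (hs : 0 < s) (N : ℕ)
    (h : ∀ n, N ≤ n → ∀ k : ℤ, μ (G ∩ Ioc ((k : ℝ) / 2 ^ n) ((k + 1) / 2 ^ n))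
      ≤ ENNReal.ofReal (((1 / 2) ^ n) ^ s))
    (hK : Measure.hausdorffMeasure s K = 0) : μ.restrict G K = 0 := by
  set C : ENNReal := 3 * 2 ^ s with hC
  have hC0 : C ≠ 0 := by simp [hC]
  have hCt : C ≠ ⊤ := ENNReal.mul_ne_top (by simp) (ENNReal.rpow_ne_top_of_nonneg hs.le (by simp))
  have hle : C⁻¹ • μ.restrict G ≤ Measure.hausdorffMeasure s := by
    refine Measure.le_hausdorffMeasure s _ (ENNReal.ofReal ((1 / 2) ^ N)) (by simp) fun U hU => ?_
    rw [Measure.smul_apply, smul_eq_mul, mul_comm, ← div_eq_mul_inv]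
    refine ENNReal.div_le_of_le_mul' ?_
    have hfin : Metric.ediam U ≠ ⊤ := ne_top_of_le_ne_top ENNReal.ofReal_ne_top hU
    set δ := (Metric.ediam U).toReal with hδ
    have hδU : Metric.ediam U = ENNReal.ofReal δ := (ENNReal.ofReal_toReal hfin).symm
    rw [hδU, ENNReal.ofReal_le_ofReal_iff (by positivity)] at hU
    have key : ∀ n, N ≤ n → δ ≤ (1 / 2) ^ n →
        μ.restrict G U ≤ 3 * ENNReal.ofReal (((1 / 2) ^ n) ^ s) := fun n hn hd =>
      restrict_le_of_ediam_le hG (h n hn) (by rw [hδU]; exact ENNReal.ofReal_le_ofReal hd)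
    have hδ0 : 0 ≤ δ := ENNReal.toReal_nonneg
    rcases hδ0.eq_or_lt with h0 | h0
    · have hlim : Tendsto (fun n : ℕ => 3 * ENNReal.ofReal ((((1 : ℝ) / 2) ^ n) ^ s)) atTop
          (nhds 0) := by
        have h1 : Tendsto (fun n : ℕ => (((1 : ℝ) / 2) ^ n) ^ s) atTop (nhds (0 ^ s)) :=
          (tendsto_pow_atTop_nhds_zero_of_lt_one (by norm_num) (by norm_num)).rpow_const
            (Or.inr hs.le)
        rw [Real.zero_rpow hs.ne'] at h1
        simpa using ENNReal.Tendsto.const_mul (a := 3) (ENNReal.tendsto_ofReal h1)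
          (Or.inr (by simp))
      refine (ge_of_tendsto hlim ?_).trans zero_le
      filter_upwards [eventually_ge_atTop N] with n hn
      exact key n hn (by rw [← h0]; positivity)
    · obtain ⟨n, hn1, hn2⟩ := exists_nat_pow_near_of_lt_one h0
        (hU.trans (pow_le_one₀ (by norm_num) (by norm_num)))
        (by norm_num : (0 : ℝ) < 1 / 2) (by norm_num)
      have hn : N ≤ n := by
        have := (pow_lt_pow_iff_right_of_lt_one₀ (by norm_num : (0 : ℝ) < 1 / 2)
          (by norm_num)).1 (hn1.trans_le hU)
        omega
      refine (key n hn hn2).trans ?_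
      rw [hδU, hC, mul_assoc, ← ENNReal.mul_rpow_of_nonneg _ _ hs.le]
      gcongr
      rw [← ENNReal.ofReal_rpow_of_nonneg (by positivity) hs.le]
      gcongr
      rw [show (2 : ENNReal) = ENNReal.ofReal 2 by simp, ← ENNReal.ofReal_mul (by norm_num)]
      apply ENNReal.ofReal_le_ofReal
      rw [pow_succ] at hn1
      linarith
  have := hle K
  rw [hK, Measure.smul_apply, smul_eq_mul, nonpos_iff_eq_zero, mul_eq_zero] at this
  exact this.resolve_left (ENNReal.inv_ne_zero.2 hCt)

theorem dyadic_mem_Icc {n k : ℕ} (hk : k < 2 ^ n) :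
    (k : ℝ) / 2 ^ n ∈ Icc (0 : ℝ) 1 ∧ ((k : ℝ) + 1) / 2 ^ n ∈ Icc (0 : ℝ) 1 := by
  have h : (k : ℝ) + 1 ≤ 2 ^ n := by exact_mod_cast hk
  have h2 : (0 : ℝ) < 2 ^ n := by positivity
  refine ⟨⟨by positivity, ?_⟩, ⟨by positivity, ?_⟩⟩ <;> rw [div_le_one h2] <;> linarith

/-- The total mass of the dyadic intervals of mass larger than `exp (-L n)` is exponentially
small, as soon as the moment sums decay fast enough. -/
theorem sum_large_dyadInc_le {f : ℝ → ℝ} {θ L : ℝ} (hθ : 0 ≤ θ) {n : ℕ}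
    (hsum : ∑ k ∈ Finset.range (2 ^ n), dyadInc f n k ^ (1 + θ)
      ≤ Real.exp (-(θ * (L + θ)) * n))
    (hpos : ∀ k, k < 2 ^ n → 0 ≤ dyadInc f n k) :
    ∑ k ∈ Finset.range (2 ^ n) with Real.exp (-(L * n)) < dyadInc f n k, dyadInc f n k
      ≤ Real.exp (-θ ^ 2) ^ n := by
  calc ∑ k ∈ Finset.range (2 ^ n) with Real.exp (-(L * n)) < dyadInc f n k, dyadInc f n k
      ≤ ∑ k ∈ Finset.range (2 ^ n) with Real.exp (-(L * n)) < dyadInc f n k,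
          Real.exp (L * n * θ) * dyadInc f n k ^ (1 + θ) := by
        refine Finset.sum_le_sum fun k hk => ?_
        have hk' := (Finset.mem_filter.1 hk).2
        have hm : 0 < dyadInc f n k := (Real.exp_pos _).trans hk'
        have h1 : Real.exp (-(L * n)) ^ θ ≤ dyadInc f n k ^ θ :=
          Real.rpow_le_rpow (Real.exp_pos _).le hk'.le hθ
        rw [← Real.exp_mul] at h1
        have h2 : Real.exp (L * n * θ) * Real.exp (-(L * n) * θ) = 1 := by
          rw [← Real.exp_add]; simp
        have h3 : 1 ≤ Real.exp (L * n * θ) * dyadInc f n k ^ θ := by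
          rw [← h2]; gcongr
        rw [Real.rpow_add hm, Real.rpow_one]
        nlinarith
    _ ≤ ∑ k ∈ Finset.range (2 ^ n), Real.exp (L * n * θ) * dyadInc f n k ^ (1 + θ) :=
        Finset.sum_le_sum_of_subset_of_nonneg (Finset.filter_subset _ _) fun k hk _ =>
          mul_nonneg (Real.exp_pos _).le (Real.rpow_nonneg (hpos k (Finset.mem_range.1 hk)) _)
    _ ≤ Real.exp (L * n * θ) * Real.exp (-(θ * (L + θ)) * n) := by
        rw [← Finset.mul_sum]; gcongr
    _ = Real.exp (-θ ^ 2) ^ n := by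
        rw [← Real.exp_add, ← Real.exp_nat_mul]; congr 1; ring

theorem measure_Ioc_eq_ofReal_sub {μ : Measure ℝ} [IsFiniteMeasure μ] {f : ℝ → ℝ}
    (hf : MonotoneOn f (Icc 0 1)) (hf0 : 0 ≤ f 0)
    (hμ : ∀ x ∈ Icc (0 : ℝ) 1, μ (Iic x) = ENNReal.ofReal (f x)) {a b : ℝ}
    (ha : a ∈ Icc (0 : ℝ) 1) (hb : b ∈ Icc (0 : ℝ) 1) (hab : a ≤ b) :
    μ (Ioc a b) = ENNReal.ofReal (f b - f a) := by
  have hfa : 0 ≤ f a := hf0.trans (hf (by simp) ha ha.1)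
  rw [← Iic_sdiff_Iic, measure_sdiff (Iic_subset_Iic.2 hab) measurableSet_Iic.nullMeasurableSet
    (measure_ne_top _ _), hμ a ha, hμ b hb, ENNReal.ofReal_sub _ hfa]

theorem measure_eq_zero_of_dimH_lt_entropy {μ : Measure ℝ} [IsFiniteMeasure μ] {f : ℝ → ℝ}
    (hf : MonotoneOn f (Icc 0 1)) (hf0 : f 0 = 0) (hf1 : f 1 = 1)
    (hμ : ∀ x ∈ Icc (0 : ℝ) 1, μ (Iic x) = ENNReal.ofReal (f x)) {c : ℝ}
    (hsplit : ∀ n k, k < 2 ^ n → ∃ p, 0 < p ∧ p < 1 ∧ c ≤ entS p ∧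
      dyadInc f (n + 1) (2 * k) = p * dyadInc f n k)
    {K : Set ℝ} (hK : K ⊆ Icc 0 1) (hdim : dimH K < ENNReal.ofReal (c / Real.log 2)) :
    μ K = 0 := by
  have hlog : 0 < Real.log 2 := Real.log_pos (by norm_num)
  obtain ⟨s, hs1, hs2⟩ := ENNReal.lt_iff_exists_nnreal_btwn.1 hdim
  have hs0 : (0 : ℝ) < s := by
    have : (0 : ENNReal) < s := lt_of_le_of_lt zero_le hs1
    exact_mod_cast this
  have hsc : (s : ℝ) * Real.log 2 < c := by
    rw [← ENNReal.ofReal_coe_nnreal, ENNReal.ofReal_lt_ofReal_iff', lt_div_iff₀ hlog] at hs2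
    exact hs2.1
  set L : ℝ := s * Real.log 2 with hL
  set θ : ℝ := (c - L) / 2 with hθ
  have hθ0 : 0 < θ := by rw [hθ]; linarith
  have hmono : ∀ n k : ℕ, (k : ℝ) / 2 ^ n ≤ ((k : ℝ) + 1) / 2 ^ n := fun n k => by
    gcongr; linarith
  have hpos : ∀ n k : ℕ, k < 2 ^ n → 0 ≤ dyadInc f n k := fun n k hk =>
    sub_nonneg.2 (hf (dyadic_mem_Icc hk).1 (dyadic_mem_Icc hk).2 (hmono n k))
  have hthr : ∀ n : ℕ, (((1 : ℝ) / 2) ^ n) ^ (s : ℝ) = Real.exp (-(L * n)) := fun n => by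
    rw [Real.rpow_def_of_pos (by positivity), Real.log_pow, one_div, Real.log_inv, hL]
    congr 1; ring
  have hIoc : ∀ n k : ℕ, k < 2 ^ n →
      μ (Ioc ((k : ℝ) / 2 ^ n) ((k + 1) / 2 ^ n)) = ENNReal.ofReal (dyadInc f n k) :=
    fun n k hk => measure_Ioc_eq_ofReal_sub hf hf0.ge hμ (dyadic_mem_Icc hk).1
      (dyadic_mem_Icc hk).2 (hmono n k)
  let B : ℕ → Set ℝ := fun n =>
    ⋃ k ∈ (Finset.range (2 ^ n)).filter fun k => Real.exp (-(L * n)) < dyadInc f n k,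
      Ioc ((k : ℝ) / 2 ^ n) ((k + 1) / 2 ^ n)
  have hBmeas : ∀ n, MeasurableSet (B n) := fun n =>
    Finset.measurableSet_biUnion _ fun k _ => measurableSet_Ioc
  have hB : ∀ n, μ (B n) ≤ ENNReal.ofReal (Real.exp (-θ ^ 2) ^ n) := fun n => by
    refine (measure_biUnion_finset_le _ _).trans ?_
    rw [Finset.sum_congr rfl fun k hk =>
      hIoc n k (Finset.mem_range.1 (Finset.mem_filter.1 hk).1),
      ← ENNReal.ofReal_sum_of_nonneg fun k hk =>
        hpos n k (Finset.mem_range.1 (Finset.mem_filter.1 hk).1)]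
    refine ENNReal.ofReal_le_ofReal (sum_large_dyadInc_le hθ0.le ?_ (hpos n))
    have h := sum_dyadInc_rpow_le hθ0.le (by simp [dyadInc, hf0, hf1]) hpos hsplit n
    rwa [show c - θ = L + θ by rw [hθ]; ring] at h
  have hlim : μ (limsup B atTop) = 0 := by
    refine measure_limsup_atTop_eq_zero (ne_top_of_le_ne_top ?_ (ENNReal.tsum_le_tsum hB))
    have hsm : Summable fun n : ℕ => Real.exp (-θ ^ 2) ^ n :=
      summable_geometric_of_lt_one (Real.exp_pos _).le
        (Real.exp_lt_one_iff.2 (neg_lt_zero.2 (by positivity)))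
    exact hsm.tsum_ofReal_ne_top
  let G : ℕ → Set ℝ := fun N => Ioc 0 1 \ ⋃ n ≥ N, B n
  have hGmeas : ∀ N, MeasurableSet (G N) := fun N =>
    measurableSet_Ioc.diff (MeasurableSet.iUnion fun n => MeasurableSet.iUnion fun _ => hBmeas n)
  have hG : ∀ N, μ (K ∩ G N) = 0 := fun N => by
    rw [← Measure.restrict_apply' (hGmeas N)]
    refine restrict_apply_eq_zero_of_hausdorffMeasure (hGmeas N) hs0 N (fun n hn k => ?_)
      (hausdorffMeasure_of_dimH_lt hs1)
    rcases (G N ∩ Ioc ((k : ℝ) / 2 ^ n) ((k + 1) / 2 ^ n)).eq_empty_or_nonempty with he | ⟨x, hx⟩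
    · simp [he]
    obtain ⟨⟨hx01, hxB⟩, hxk⟩ := hx
    have h2 : (0 : ℝ) < 2 ^ n := by positivity
    have hk0 : 0 ≤ k := by
      have h : (0 : ℝ) < k + 1 := (div_pos_iff_of_pos_right h2).1 (hx01.1.trans_le hxk.2)
      have : 0 < k + 1 := by exact_mod_cast h
      omega
    lift k to ℕ using hk0
    have hkn : k < 2 ^ n := by
      have h := hxk.1.trans_le hx01.2
      rw [div_lt_one h2] at h
      exact_mod_cast h
    simp only [Int.cast_natCast] at hxk ⊢
    refine (measure_mono inter_subset_right).trans ?_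
    rw [hIoc n k hkn, hthr]
    refine ENNReal.ofReal_le_ofReal (not_lt.1 fun hlt => hxB ?_)
    exact mem_iUnion₂.2 ⟨n, hn, mem_iUnion₂.2
      ⟨k, Finset.mem_filter.2 ⟨Finset.mem_range.2 hkn, hlt⟩, hxk⟩⟩
  have h0 : μ (Iic 0) = 0 := by rw [hμ 0 (by simp), hf0, ENNReal.ofReal_zero]
  refine measure_mono_null (t := Iic 0 ∪ (limsup B atTop ∪ ⋃ N, K ∩ G N)) (fun x hx => ?_)
    (measure_union_null h0 (measure_union_null hlim (measure_iUnion_null hG)))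
  by_cases hx0 : x ≤ 0
  · exact Or.inl hx0
  by_cases hxl : x ∈ limsup B atTop
  · exact Or.inr (Or.inl hxl)
  rw [mem_limsup_iff_frequently_mem, not_frequently, eventually_atTop] at hxl
  obtain ⟨N, hN⟩ := hxl
  refine Or.inr (Or.inr (mem_iUnion.2 ⟨N, hx, ⟨not_le.1 hx0, (hK hx).2⟩, fun hxB => ?_⟩))
  obtain ⟨n, hn, hxn⟩ := mem_iUnion₂.1 hxB
  exact hN n hn hxn

theorem linearFractional_div (A B y X : ℝ) {Z : ℝ} (hZ : Z ≠ 0) :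
    (A * (X / Z) + B) / (y * (X / Z) + 1) = (A * X + B * Z) / (y * X + Z) := by
  rw [← mul_div_mul_right _ _ hZ]
  congr 1 <;> field_simp

theorem linearFractional_normalize (P Q R v : ℝ) {W : ℝ} (hW : W ≠ 0) :
    (P / W * v + Q / W) / (R / W * v + 1) = (P * v + Q) / (R * v + W) := by
  rw [← mul_div_mul_right _ _ hW]
  congr 1 <;> field_simp

theorem mul_add_pos_of_mem_Icc {c d v : ℝ} (hd : 0 < d) (hcd : 0 < c + d)
    (hv : v ∈ Icc (0 : ℝ) 1) : 0 < c * v + d := by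
  rcases hv.1.eq_or_lt with h | h
  · simpa [← h] using hd
  · nlinarith [mul_pos h hcd, mul_nonneg (sub_nonneg.2 hv.2) hd.le]

/-- On each dyadic interval, `f` is the image of a rescaled copy of itself under a linear
fractional map, whose normalized lower-left coefficient stays in any interval stable under the
two coefficient updates. -/
theorem exists_linearFractional_dyadic {f : ℝ → ℝ} {a0 c0 d0 a1 b1 c1 d1 α β : ℝ}
    (hdR0 : ∀ x ∈ Icc (0 : ℝ) (1 / 2), f x = Phi a0 0 c0 d0 (f (2 * x)))
    (hdR1 : ∀ x ∈ Icc (1 / 2 : ℝ) 1, f x = Phi a1 b1 c1 d1 (f (2 * x - 1)))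
    (hf : ∀ x ∈ Icc (0 : ℝ) 1, f x ∈ Icc (0 : ℝ) 1)
    (h0 : (0 : ℝ) ∈ Icc α β)
    (hd0 : 0 < d0) (hcd0 : 0 < c0 + d0) (hcd1 : 0 < c1 + d1) (hd1 : 0 < d1)
    (hT0 : ∀ y ∈ Icc α β, (a0 * y + c0) / d0 ∈ Icc α β)
    (hT1 : ∀ y ∈ Icc α β, 0 < b1 * y + d1 ∧ (a1 * y + c1) / (b1 * y + d1) ∈ Icc α β)
    (n : ℕ) : ∀ k : ℕ, k < 2 ^ n → ∃ A B, ∃ y ∈ Icc α β, ∀ u ∈ Icc (0 : ℝ) 1,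
      f ((k + u) / 2 ^ n) = (A * f u + B) / (y * f u + 1) := by
  induction n with
  | zero =>
    intro k hk
    obtain rfl : k = 0 := by simpa using hk
    exact ⟨1, 0, 0, h0, fun u _ => by simp⟩
  | succ n ih =>
    intro k hk
    obtain ⟨j, hj⟩ := k.even_or_odd'
    obtain ⟨A, B, y, hy, hAB⟩ := ih j (by rw [pow_succ] at hk; omega)
    rcases hj with rfl | rfl
    · refine ⟨(A * a0 + B * c0) / d0, B * d0 / d0, _, hT0 y hy, fun u hu => ?_⟩
      have hv : u / 2 ∈ Icc (0 : ℝ) (1 / 2) := ⟨by linarith [hu.1], by linarith [hu.2]⟩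
      have h := hdR0 _ hv
      rw [mul_div_cancel₀ u (two_ne_zero), Phi, add_zero] at h
      have hden : c0 * f u + d0 ≠ 0 := (mul_add_pos_of_mem_Icc hd0 hcd0 (hf u hu)).ne'
      have e : ((2 * j : ℕ) + u) / 2 ^ (n + 1) = (j + u / 2) / 2 ^ n := by
        push_cast; field_simp; ring
      rw [e, hAB _ ⟨hv.1, by linarith [hv.2]⟩, h, linearFractional_div _ _ _ _ hden,
        linearFractional_normalize _ _ _ _ hd0.ne']
      congr 1 <;> ring
    · obtain ⟨hpos, hmem⟩ := hT1 y hy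
      refine ⟨(A * a1 + B * c1) / (b1 * y + d1), (A * b1 + B * d1) / (b1 * y + d1), _, hmem,
        fun u hu => ?_⟩
      have hv : (1 + u) / 2 ∈ Icc (1 / 2 : ℝ) 1 := ⟨by linarith [hu.1], by linarith [hu.2]⟩
      have h := hdR1 _ hv
      rw [mul_div_cancel₀ _ (two_ne_zero), add_sub_cancel_left, Phi] at h
      have hden : c1 * f u + d1 ≠ 0 := (mul_add_pos_of_mem_Icc hd1 hcd1 (hf u hu)).ne'
      have e : ((2 * j + 1 : ℕ) + u) / 2 ^ (n + 1) = (j + (1 + u) / 2) / 2 ^ n := by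
        push_cast; field_simp; ring
      rw [e, hAB _ ⟨by linarith [hv.1], hv.2⟩, h, linearFractional_div _ _ _ _ hden,
        linearFractional_normalize _ _ _ _ hpos.ne']
      congr 1 <;> ring

/-- The left half of a dyadic interval carries the fraction `(y + 1) / (y + γ)` of its
increment. -/
theorem dyadInc_left_eq {f : ℝ → ℝ} {A B y γ : ℝ} {n k : ℕ} (hf0 : f 0 = 0) (hf1 : f 1 = 1)
    (hhalf : f (1 / 2) = 1 / γ) (hγ : 1 < γ) (hy : -1 < y)
    (h : ∀ u ∈ Icc (0 : ℝ) 1, f ((k + u) / 2 ^ n) = (A * f u + B) / (y * f u + 1)) :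
    dyadInc f (n + 1) (2 * k) = (y + 1) / (y + γ) * dyadInc f n k := by
  have e0 := h 0 (by simp)
  have e1 := h 1 (by simp)
  have e2 := h (1 / 2) ⟨by norm_num, by norm_num⟩
  rw [hf0, add_zero] at e0
  rw [hf1] at e1
  rw [hhalf] at e2
  have g1 : ((2 * k : ℕ) + 1 : ℝ) / 2 ^ (n + 1) = (k + 1 / 2) / 2 ^ n := by
    push_cast; field_simp; ring
  have g2 : ((2 * k : ℕ) : ℝ) / 2 ^ (n + 1) = k / 2 ^ n := by
    push_cast; field_simp; ring
  have p1 : y + 1 ≠ 0 := by linarith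
  have p2 : y + γ ≠ 0 := by linarith
  have p3 : γ ≠ 0 := by linarith
  have p4 : y * (1 / γ) + 1 = (y + γ) / γ := by field_simp
  unfold dyadInc
  rw [g1, g2, e0, e1, e2, p4]
  simp only [mul_zero, mul_one, zero_add, div_one]
  field_simp
  ring

theorem stmt1
    (a0 b0 c0 d0 a1 b1 c1 d1 : ℝ)
    (hb0 : b0 = 0)
    (hA1a : 0 < (a0 + b0) / (c0 + d0))
    (hA1b : (a0 + b0) / (c0 + d0) = b1 / d1)
    (hA1c : b1 / d1 < (a1 + b1) / (c1 + d1))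
    (hA1d : (a1 + b1) / (c1 + d1) = 1)
    (hA20 : 0 < a0 * d0 - b0 * c0)
    (hA21 : 0 < a1 * d1 - b1 * c1)
    (hA30 : Real.sqrt (a0 * d0 - b0 * c0) < min d0 (c0 + d0))
    (hA31 : Real.sqrt (a1 * d1 - b1 * c1) < min d1 (c1 + d1))
    (f : ℝ → ℝ)
    (hfc : ContinuousOn f (Set.Icc 0 1))
    (hfm : StrictMonoOn f (Set.Icc 0 1))
    (hf0 : f 0 = 0) (hf1 : f 1 = 1)
    (hdR0 : ∀ x ∈ Set.Icc (0 : ℝ) (1 / 2), f x = Phi a0 b0 c0 d0 (f (2 * x)))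
    (hdR1 : ∀ x ∈ Set.Icc (1 / 2 : ℝ) 1, f x = Phi a1 b1 c1 d1 (f (2 * x - 1)))
    (μf : Measure ℝ) [IsProbabilityMeasure μf]
    (hμf : ∀ x ∈ Set.Icc (0 : ℝ) 1, μf (Set.Iic x) = ENNReal.ofReal (f x))
    (γ : ℝ) (hγ : γ = 1 / Phi a0 b0 c0 d0 1)
    (α : ℝ) (hα : α = min (min 0 (c0 / (d0 - a0))) (c1 / b1))
    (β : ℝ) (hβ : β = max (max 0 (c0 / (d0 - a0))) (c1 / b1))
    :
    ∀ K : Set ℝ, MeasurableSet K → K ⊆ Set.Icc 0 1 →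
      dimH K < ENNReal.ofReal
        (sInf ((fun y => entS ((y + 1) / (y + γ))) '' Set.Icc α β) / Real.log 2) →
      μf K = 0 := by
  subst hb0
  simp only [add_zero, zero_mul, sub_zero] at *
  obtain ⟨hd0, hcd0⟩ := lt_min_iff.1 hA30
  obtain ⟨hd1, hcd1⟩ := lt_min_iff.1 hA31
  have hd0' : 0 < d0 := (Real.sqrt_nonneg _).trans_lt hd0
  have hcd0' : 0 < c0 + d0 := (Real.sqrt_nonneg _).trans_lt hcd0
  have hd1' : 0 < d1 := (Real.sqrt_nonneg _).trans_lt hd1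
  have hcd1' : 0 < c1 + d1 := (Real.sqrt_nonneg _).trans_lt hcd1
  rw [Real.sqrt_lt' hd0'] at hd0
  rw [Real.sqrt_lt' hcd1'] at hcd1
  have ha0 : 0 < a0 := (div_pos_iff_of_pos_right hcd0').1 hA1a
  have had0 : 0 < d0 - a0 := by nlinarith
  have hsum1 : a1 + b1 = c1 + d1 := (div_eq_one_iff_eq hcd1'.ne').1 hA1d
  have hb1 : 0 < b1 := (div_pos_iff_of_pos_right hd1').1 (hA1b ▸ hA1a)
  rw [hA1d] at hA1c
  have hbd1 : 0 < d1 - b1 := by rw [div_lt_one hd1'] at hA1c; linarith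
  have ht1 : a0 / (c0 + d0) < 1 := hA1b ▸ hA1c
  have hacd0 : a0 < c0 + d0 := (div_lt_one hcd0').1 ht1
  have hbc1 : 0 < b1 + c1 := by
    have hdet : a1 * d1 - b1 * c1 = (c1 + d1) * (d1 - b1) := by
      rw [show a1 = c1 + d1 - b1 by linarith]; ring
    rw [hdet, sq] at hcd1
    linarith [lt_of_mul_lt_mul_left hcd1 hcd1'.le]
  have hPhi : Phi a0 0 c0 d0 1 = a0 / (c0 + d0) := by simp [Phi]
  rw [hPhi] at hγ
  have hγ1 : 1 < γ := by rw [hγ]; exact (one_lt_div hA1a).2 ht1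
  have hα1 : -1 < α := by
    rw [hα, lt_min_iff, lt_min_iff, lt_div_iff₀ had0, lt_div_iff₀ hb1]
    exact ⟨⟨by norm_num, by linarith⟩, by linarith⟩
  have hα0 : α ≤ 0 := by rw [hα]; exact (min_le_left _ _).trans (min_le_left _ _)
  have hβ0 : 0 ≤ β := by rw [hβ]; exact (le_max_left _ _).trans (le_max_left _ _)
  have hαe0 : α * (d0 - a0) ≤ c0 := by
    rw [← le_div_iff₀ had0, hα]; exact (min_le_left _ _).trans (min_le_right _ _)
  have hβe0 : c0 ≤ β * (d0 - a0) := by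
    rw [← div_le_iff₀ had0, hβ]; exact (le_max_right _ _).trans (le_max_left _ _)
  have hαe1 : α * b1 ≤ c1 := by rw [← le_div_iff₀ hb1, hα]; exact min_le_right _ _
  have hβe1 : c1 ≤ β * b1 := by rw [← div_le_iff₀ hb1, hβ]; exact le_max_right _ _
  have hfmem : ∀ x ∈ Icc (0 : ℝ) 1, f x ∈ Icc (0 : ℝ) 1 := fun x hx =>
    ⟨hf0 ▸ hfm.monotoneOn (by simp) hx hx.1, hf1 ▸ hfm.monotoneOn hx (by simp) hx.2⟩
  have hT0 : ∀ y ∈ Icc α β, (a0 * y + c0) / d0 ∈ Icc α β := fun y hy => by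
    rw [mem_Icc, le_div_iff₀ hd0', div_le_iff₀ hd0']
    constructor
    · linarith [mul_le_mul_of_nonneg_left hy.1 ha0.le]
    · linarith [mul_le_mul_of_nonneg_left hy.2 ha0.le]
  have hT1 : ∀ y ∈ Icc α β, 0 < b1 * y + d1 ∧ (a1 * y + c1) / (b1 * y + d1) ∈ Icc α β :=
    fun y hy => by
      have hy1 : 0 < y + 1 := by linarith [hy.1]
      have hden : 0 < b1 * y + d1 := by linarith [mul_pos hb1 hy1]
      refine ⟨hden, ?_⟩
      obtain rfl : a1 = c1 + d1 - b1 := by linarith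
      rw [mem_Icc, le_div_iff₀ hden, div_le_iff₀ hden]
      constructor
      · linarith [mul_nonneg (sub_nonneg.2 hy.1) hbd1.le,
          mul_nonneg (sub_nonneg.2 hαe1) hy1.le]
      · linarith [mul_nonneg (sub_nonneg.2 hy.2) hbd1.le,
          mul_nonneg (sub_nonneg.2 hβe1) hy1.le]
  have hhalf : f (1 / 2) = 1 / γ := by
    rw [hdR0 (1 / 2) (by norm_num), show (2 : ℝ) * (1 / 2) = 1 by norm_num, hf1, hPhi, hγ,
      one_div_one_div]
  have hp : ∀ y ∈ Icc α β, 0 < (y + 1) / (y + γ) ∧ (y + 1) / (y + γ) < 1 := fun y hy => by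
    have hy1 : 0 < y + 1 := by linarith [hy.1]
    have hyγ : 0 < y + γ := by linarith
    exact ⟨div_pos hy1 hyγ, (div_lt_one hyγ).2 (by linarith)⟩
  intro K _ hK hdim
  refine measure_eq_zero_of_dimH_lt_entropy hfm.monotoneOn hf0 hf1 hμf (fun n k hk => ?_) hK hdim
  obtain ⟨A, B, y, hy, hAB⟩ := exists_linearFractional_dyadic hdR0 hdR1 hfmem ⟨hα0, hβ0⟩ hd0'
    hcd0' hcd1' hd1' hT0 hT1 n k hk
  refine ⟨(y + 1) / (y + γ), (hp y hy).1, (hp y hy).2, csInf_le ⟨0, ?_⟩ ⟨y, hy, rfl⟩,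
    dyadInc_left_eq hf0 hf1 hhalf hγ1 (hα1.trans_le hy.1) hAB⟩
  rintro _ ⟨z, hz, rfl⟩
  exact entS_nonneg (hp z hz).1.le (hp z hz).2.le
end

section
/- For every n ≥ 1, the conditional expectation E^{μ_f}[−log(R_{n+1}/R_n) | ℱ_n] equals the function x ↦ s(p_0(r_n(x)/s_n(x))) μ_f-almost everywhere; equivalently, L_{n+1}(x) − L_n(x) = s(p_0(r_n(x)/s_n(x))) for μ_f-a.e. x ∈ [0, 1). -/
open MeasureTheory Filter Set Matrix

theorem floor_two_pow_mul_of_le {i n : ℕ} (h : i ≤ n) (x : ℝ) :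
    ⌊(2 : ℝ) ^ i * x⌋₊ = ⌊(2 : ℝ) ^ n * x⌋₊ / 2 ^ (n - i) := by
  rw [← Nat.floor_div_natCast]
  congr 1
  obtain ⟨m, rfl⟩ := Nat.exists_eq_add_of_le h
  rw [Nat.add_sub_cancel_left]
  push_cast
  rw [pow_add]
  field_simp

theorem floor_two_pow_mul_congr {i n : ℕ} (h : i ≤ n) {x y : ℝ}
    (hxy : ⌊(2 : ℝ) ^ n * x⌋₊ = ⌊(2 : ℝ) ^ n * y⌋₊) :
    ⌊(2 : ℝ) ^ i * x⌋₊ = ⌊(2 : ℝ) ^ i * y⌋₊ := by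
  rw [floor_two_pow_mul_of_le h, floor_two_pow_mul_of_le h, hxy]

theorem Xdig_congr {i n : ℕ} (h : i ≤ n) {x y : ℝ}
    (hxy : ⌊(2 : ℝ) ^ n * x⌋₊ = ⌊(2 : ℝ) ^ n * y⌋₊) : Xdig x i = Xdig y i := by
  unfold Xdig
  rw [floor_two_pow_mul_congr h hxy, floor_two_pow_mul_congr ((Nat.sub_le i 1).trans h) hxy]

theorem floor_succ_eq (x : ℝ) (n : ℕ) :
    ⌊(2 : ℝ) ^ (n + 1) * x⌋₊ = 2 * ⌊(2 : ℝ) ^ n * x⌋₊ + Xdig x (n + 1) ∧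
      (Xdig x (n + 1) = 0 ∨ Xdig x (n + 1) = 1) := by
  have h := floor_two_pow_mul_of_le (Nat.le_succ n) x
  have h2 : n.succ - n = 1 := by omega
  rw [h2, pow_one] at h
  simp only [Xdig, Nat.add_sub_cancel]
  simp only [Nat.succ_eq_add_one] at h
  omega

theorem matProd_congr (A : ℕ → Matrix (Fin 2) (Fin 2) ℝ) {n : ℕ} {x y : ℝ}
    (hxy : ⌊(2 : ℝ) ^ n * x⌋₊ = ⌊(2 : ℝ) ^ n * y⌋₊) : matProd A x n = matProd A y n := by
  unfold matProd
  congr 1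
  apply List.map_congr_left
  intro j hj
  rw [Xdig_congr (List.mem_range.1 hj) hxy]

theorem matProd_succ (A : ℕ → Matrix (Fin 2) (Fin 2) ℝ) (x : ℝ) (n : ℕ) :
    matProd A x (n + 1) = matProd A x n * A (Xdig x (n + 1)) := by
  simp [matProd, List.range_succ]

theorem Rfun_congr (μ : Measure ℝ) {i n : ℕ} (h : i ≤ n) {x y : ℝ}
    (hxy : ⌊(2 : ℝ) ^ n * x⌋₊ = ⌊(2 : ℝ) ^ n * y⌋₊) : Rfun μ x i = Rfun μ y i := by
  simp only [Rfun, dyadI, floor_two_pow_mul_congr h hxy]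

theorem measurable_Xdig (i : ℕ) : Measurable (fun x : ℝ => Xdig x i) := by
  unfold Xdig
  fun_prop

theorem Fcal_le_borel (n : ℕ) : Fcal n ≤ (inferInstance : MeasurableSpace ℝ) :=
  iSup₂_le fun i _ => (measurable_Xdig i).comap_le

theorem measurable_Xdig_Fcal {i n : ℕ} (h1 : 1 ≤ i) (h : i ≤ n) :
    Measurable[Fcal n] (fun x : ℝ => Xdig x i) := by
  rw [measurable_iff_comap_le]
  exact le_iSup₂_of_le (f := fun i (_ : i ∈ Finset.Icc 1 n) =>
    MeasurableSpace.comap (fun x : ℝ => Xdig x i) ⊤) i (Finset.mem_Icc.2 ⟨h1, h⟩) le_rfl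

theorem Fcal_mem_congr {n : ℕ} {S : Set ℝ} (hS : MeasurableSet[Fcal n] S) {x y : ℝ}
    (hxy : ⌊(2 : ℝ) ^ n * x⌋₊ = ⌊(2 : ℝ) ^ n * y⌋₊) : x ∈ S ↔ y ∈ S := by
  have hle : Fcal n ≤ MeasurableSpace.comap (fun x : ℝ => ⌊(2 : ℝ) ^ n * x⌋₊) ⊤ := by
    refine iSup₂_le fun i hi => ?_
    rintro _ ⟨T, -, rfl⟩
    refine ⟨(fun k => k / 2 ^ (n - i) - 2 * (k / 2 ^ (n - (i - 1)))) ⁻¹' T, trivial, ?_⟩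
    have hi' := (Finset.mem_Icc.1 hi).2
    ext x
    simp only [Set.mem_preimage, Xdig, floor_two_pow_mul_of_le hi',
      floor_two_pow_mul_of_le ((Nat.sub_le i 1).trans hi')]
  obtain ⟨T, -, rfl⟩ := hle S hS
  simp only [Set.mem_preimage, hxy]

theorem measurable_matProd_Fcal (A : ℕ → Matrix (Fin 2) (Fin 2) ℝ) {m n : ℕ} (h : m ≤ n)
    (i j : Fin 2) : Measurable[Fcal n] (fun x : ℝ => matProd A x m i j) := by
  induction m generalizing i j with
  | zero => simp [matProd]
  | succ m ih =>
    have hA : ∀ k, Measurable[Fcal n] (fun x : ℝ => A (Xdig x (m + 1)) k j) := fun k =>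
      (measurable_from_top (f := fun l => A l k j)).comp
        (measurable_Xdig_Fcal (Nat.le_add_left 1 m) h)
    simp only [matProd_succ, Matrix.mul_apply, Fin.sum_univ_two]
    exact ((ih (by omega) i 0).mul (hA 0)).add ((ih (by omega) i 1).mul (hA 1))

theorem measurable_entS : Measurable entS := by
  unfold entS
  fun_prop

theorem sum_range_two_mul_s9 (F : ℕ → ℝ) (N : ℕ) :
    ∑ k ∈ Finset.range (2 * N), F k = ∑ j ∈ Finset.range N, (F (2 * j) + F (2 * j + 1)) := by
  induction N with
  | zero => simp
  | succ N ih =>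
    rw [Nat.mul_succ, Finset.sum_range_succ, Finset.sum_range_succ, ih, Finset.sum_range_succ]
    ring

theorem mem_dyadic_iff {m k : ℕ} {x : ℝ} (hx : 0 ≤ x) :
    x ∈ Set.Ico ((k : ℝ) / 2 ^ m) (((k : ℝ) + 1) / 2 ^ m) ↔ ⌊(2 : ℝ) ^ m * x⌋₊ = k := by
  have h2 : (0 : ℝ) < 2 ^ m := by positivity
  rw [Nat.floor_eq_iff (by positivity), Set.mem_Ico, div_le_iff₀ h2, lt_div_iff₀ h2,
    mul_comm x]

theorem floor_two_pow_mul_lt {m : ℕ} {x : ℝ} (hx : x ∈ Set.Ico (0 : ℝ) 1) :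
    ⌊(2 : ℝ) ^ m * x⌋₊ < 2 ^ m := by
  have h2 : (0 : ℝ) < 2 ^ m := by positivity
  rw [Nat.floor_lt (mul_nonneg h2.le hx.1)]
  push_cast
  nlinarith [hx.2]

theorem dyadic_mem_Ico {m k : ℕ} (hk : k < 2 ^ m) : (k : ℝ) / 2 ^ m ∈ Set.Ico (0 : ℝ) 1 := by
  have h2 : (0 : ℝ) < 2 ^ m := by positivity
  refine ⟨by positivity, ?_⟩
  rw [div_lt_one h2]
  exact_mod_cast hk

theorem floor_dyadic (m k : ℕ) : ⌊(2 : ℝ) ^ m * ((k : ℝ) / 2 ^ m)⌋₊ = k := by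
  rw [mul_div_cancel₀ _ (by positivity), Nat.floor_natCast]

/-- A function that is constant on the dyadic intervals of level `m` is integrable, and its
integral is a finite sum. -/
theorem integral_of_dyadic_const (μ : Measure ℝ) [IsProbabilityMeasure μ]
    (hμ : ∀ᵐ x ∂μ, x ∈ Set.Ico (0 : ℝ) 1) (m : ℕ) (u : ℝ → ℝ)
    (hu : ∀ x ∈ Set.Ico (0 : ℝ) 1, ∀ y ∈ Set.Ico (0 : ℝ) 1,
      ⌊(2 : ℝ) ^ m * x⌋₊ = ⌊(2 : ℝ) ^ m * y⌋₊ → u x = u y) :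
    Integrable u μ ∧ ∫ x, u x ∂μ = ∑ k ∈ Finset.range (2 ^ m),
      (μ (Set.Ico ((k : ℝ) / 2 ^ m) (((k : ℝ) + 1) / 2 ^ m))).toReal * u ((k : ℝ) / 2 ^ m) := by
  set J : ℕ → Set ℝ := fun k => Set.Ico ((k : ℝ) / 2 ^ m) (((k : ℝ) + 1) / 2 ^ m) with hJ
  have hae : u =ᵐ[μ] fun x => ∑ k ∈ Finset.range (2 ^ m),
      (J k).indicator (fun _ => u ((k : ℝ) / 2 ^ m)) x := by
    filter_upwards [hμ] with x hx
    have hlt := floor_two_pow_mul_lt (m := m) hx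
    rw [Finset.sum_eq_single_of_mem _ (Finset.mem_range.2 hlt),
      Set.indicator_of_mem ((mem_dyadic_iff hx.1).2 rfl)]
    · exact hu x hx _ (dyadic_mem_Ico hlt) (floor_dyadic m _).symm
    · intro k _ hk
      exact Set.indicator_of_notMem (fun h => hk ((mem_dyadic_iff hx.1).1 h).symm) _
  have hint : ∀ k ∈ Finset.range (2 ^ m),
      Integrable ((J k).indicator (fun _ => u ((k : ℝ) / 2 ^ m))) μ := fun k _ =>
    (integrable_const _).indicator measurableSet_Ico
  refine ⟨(integrable_finsetSum _ hint).congr ?_, ?_⟩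
  · exact hae.symm
  · rw [integral_congr_ae hae, integral_finsetSum _ hint]
    refine Finset.sum_congr rfl fun k _ => ?_
    rw [integral_indicator_const _ measurableSet_Ico]
    rfl

section DistributionFunction

variable {f : ℝ → ℝ} {μ : Measure ℝ}

theorem measure_Ioc_of_cdf (hfm : StrictMonoOn f (Set.Icc 0 1)) (hf0 : f 0 = 0)
    (hμ : ∀ x ∈ Set.Icc (0 : ℝ) 1, μ (Set.Iic x) = ENNReal.ofReal (f x))
    {a b : ℝ} (ha : 0 ≤ a) (hab : a ≤ b) (hb : b ≤ 1) :
    μ (Set.Ioc a b) = ENNReal.ofReal (f b - f a) := by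
  have hfa : 0 ≤ f a := by
    rw [← hf0]
    exact hfm.monotoneOn ⟨le_rfl, zero_le_one⟩ ⟨ha, hab.trans hb⟩ ha
  rw [← Set.Iic_sdiff_Iic, measure_sdiff (Set.Iic_subset_Iic.2 hab)
    measurableSet_Iic.nullMeasurableSet, hμ b ⟨ha.trans hab, hb⟩, hμ a ⟨ha, hab.trans hb⟩,
    ENNReal.ofReal_sub _ hfa]
  rw [hμ a ⟨ha, hab.trans hb⟩]
  exact ENNReal.ofReal_ne_top

theorem measure_singleton_of_cdf (hfc : ContinuousOn f (Set.Icc 0 1))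
    (hfm : StrictMonoOn f (Set.Icc 0 1)) (hf0 : f 0 = 0)
    (hμ : ∀ x ∈ Set.Icc (0 : ℝ) 1, μ (Set.Iic x) = ENNReal.ofReal (f x))
    {x : ℝ} (hx : x ∈ Set.Icc (0 : ℝ) 1) : μ {x} = 0 := by
  rcases hx.1.eq_or_lt with rfl | h0
  · refine measure_mono_null (t := Set.Iic 0) (by simp) ?_
    rw [hμ 0 hx, hf0, ENNReal.ofReal_zero]
  · have hlim : Tendsto (fun a => ENNReal.ofReal (f x - f a)) (nhdsWithin x (Set.Ico 0 x))
        (nhds (ENNReal.ofReal (f x - f x))) := by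
      refine ENNReal.tendsto_ofReal (tendsto_const_nhds.sub ?_)
      exact ((hfc x hx).mono fun y hy => ⟨hy.1, hy.2.le.trans hx.2⟩)
    rw [sub_self, ENNReal.ofReal_zero] at hlim
    have : (nhdsWithin x (Set.Ico 0 x)).NeBot := by
      rw [nhdsWithin_Ico_eq_nhdsLT h0]
      infer_instance
    refine le_antisymm (ge_of_tendsto hlim ?_) zero_le
    filter_upwards [self_mem_nhdsWithin] with a ha
    rw [← measure_Ioc_of_cdf hfm hf0 hμ ha.1 ha.2.le hx.2]
    exact measure_mono (by simpa using ha.2)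

theorem measure_Ico_of_cdf (hfc : ContinuousOn f (Set.Icc 0 1))
    (hfm : StrictMonoOn f (Set.Icc 0 1)) (hf0 : f 0 = 0)
    (hμ : ∀ x ∈ Set.Icc (0 : ℝ) 1, μ (Set.Iic x) = ENNReal.ofReal (f x))
    {a b : ℝ} (ha : 0 ≤ a) (hab : a ≤ b) (hb : b ≤ 1) :
    μ (Set.Ico a b) = ENNReal.ofReal (f b - f a) := by
  rw [← measure_Ioc_of_cdf hfm hf0 hμ ha hab hb]
  have hs : ∀ x ∈ Set.Icc (0 : ℝ) 1, μ {x} = 0 := fun x hx =>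
    measure_singleton_of_cdf hfc hfm hf0 hμ hx
  exact measure_congr ((Ico_ae_eq_Icc' (hs b ⟨ha.trans hab, hb⟩)).trans
    (Ioc_ae_eq_Icc' (hs a ⟨ha, hab.trans hb⟩)).symm)

theorem toReal_measure_dyadic_of_cdf (hfc : ContinuousOn f (Set.Icc 0 1))
    (hfm : StrictMonoOn f (Set.Icc 0 1)) (hf0 : f 0 = 0)
    (hμ : ∀ x ∈ Set.Icc (0 : ℝ) 1, μ (Set.Iic x) = ENNReal.ofReal (f x))
    {m k : ℕ} (hk : k < 2 ^ m) :
    (μ (Set.Ico ((k : ℝ) / 2 ^ m) (((k : ℝ) + 1) / 2 ^ m))).toReal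
      = f (((k : ℝ) + 1) / 2 ^ m) - f ((k : ℝ) / 2 ^ m) := by
  have h2 : (0 : ℝ) < 2 ^ m := by positivity
  have h0 := (dyadic_mem_Ico hk)
  have hle : (k : ℝ) / 2 ^ m ≤ ((k : ℝ) + 1) / 2 ^ m := by gcongr; linarith
  have h1 : ((k : ℝ) + 1) / 2 ^ m ≤ 1 := by
    rw [div_le_one h2]
    exact_mod_cast hk
  rw [measure_Ico_of_cdf hfc hfm hf0 hμ h0.1 hle h1, ENNReal.toReal_ofReal]
  exact sub_nonneg.2 (hfm.monotoneOn ⟨h0.1, h0.2.le⟩ ⟨h0.1.trans hle, h1⟩ hle)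

end DistributionFunction

/-- A convex-combination bound: the denominator of a Möbius map is positive on `[0, 1]` as soon
as it is positive at both endpoints. -/
theorem denom_pos {r s z : ℝ} (hs : 0 < s) (hrs : 0 < r + s) (hz0 : 0 ≤ z) (hz1 : z ≤ 1) :
    0 < r * z + s := by
  rcases hz1.eq_or_lt with rfl | h
  · linarith
  · nlinarith [mul_pos hs (sub_pos.2 h), mul_nonneg hrs.le hz0]

theorem PhiM_mul {M N : Matrix (Fin 2) (Fin 2) ℝ} {z : ℝ} (hN : N 1 0 * z + N 1 1 ≠ 0) :
    PhiM (M * N) z = PhiM M (PhiM N z) := by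
  unfold PhiM
  simp only [Matrix.mul_apply, Fin.sum_univ_two]
  rw [← mul_div_mul_right (M 0 0 * _ + M 0 1) _ hN]
  congr 1
  · field_simp
    ring
  · field_simp
    ring

theorem denom_pos_mul {M N : Matrix (Fin 2) (Fin 2) ℝ} (hM : 0 < M 1 1) (hM' : 0 < M 1 0 + M 1 1)
    (hN : 0 < N 1 1) (hN' : 0 < N 1 0 + N 1 1)
    (h0 : PhiM N 0 ∈ Set.Icc (0 : ℝ) 1) (h1 : PhiM N 1 ∈ Set.Icc (0 : ℝ) 1) :
    0 < (M * N) 1 1 ∧ 0 < (M * N) 1 0 + (M * N) 1 1 := by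
  have e0 : (M * N) 1 1 = N 1 1 * (M 1 0 * PhiM N 0 + M 1 1) := by
    simp only [Matrix.mul_apply, Fin.sum_univ_two, PhiM, mul_zero, zero_add]
    field_simp
  have e1 : (M * N) 1 0 + (M * N) 1 1 = (N 1 0 + N 1 1) * (M 1 0 * PhiM N 1 + M 1 1) := by
    simp only [Matrix.mul_apply, Fin.sum_univ_two, PhiM, mul_one]
    field_simp
    ring
  rw [e1, e0]
  exact ⟨mul_pos hN (denom_pos hM hM' h0.1 h0.2), mul_pos hN' (denom_pos hM hM' h1.1 h1.2)⟩

/-- Iterating de Rham's equation along the binary digits of `x`. -/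
theorem deRham_iterate (A : ℕ → Matrix (Fin 2) (Fin 2) ℝ) (f : ℝ → ℝ)
    (hf : ∀ t ∈ Set.Icc (0 : ℝ) 1, f t ∈ Set.Icc (0 : ℝ) 1)
    (hd : ∀ e : ℕ, e = 0 ∨ e = 1 → 0 < A e 1 1 ∧ 0 < A e 1 0 + A e 1 1 ∧
      PhiM (A e) 0 ∈ Set.Icc (0 : ℝ) 1 ∧ PhiM (A e) 1 ∈ Set.Icc (0 : ℝ) 1 ∧
      ∀ t ∈ Set.Icc (0 : ℝ) 1, f ((e + t) / 2) = PhiM (A e) (f t))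
    {x : ℝ} (hx : x ∈ Set.Ico (0 : ℝ) 1) (n : ℕ) :
    0 < matProd A x n 1 1 ∧ 0 < matProd A x n 1 0 + matProd A x n 1 1 ∧
      ∀ t ∈ Set.Icc (0 : ℝ) 1,
        f (((⌊(2 : ℝ) ^ n * x⌋₊ : ℝ) + t) / 2 ^ n) = PhiM (matProd A x n) (f t) := by
  induction n with
  | zero =>
    have : ⌊x⌋₊ = 0 := Nat.floor_eq_zero.2 hx.2
    simp [matProd, PhiM, this]
  | succ n ih =>
    obtain ⟨h1, h2, h3⟩ := ih
    obtain ⟨hfl, he⟩ := floor_succ_eq x n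
    obtain ⟨g1, g2, g3, g4, g5⟩ := hd _ he
    rw [matProd_succ, hfl]
    obtain ⟨k1, k2⟩ := denom_pos_mul h1 h2 g1 g2 g3 g4
    refine ⟨k1, k2, fun t ht => ?_⟩
    have hft := hf t ht
    rw [PhiM_mul (denom_pos g1 g2 hft.1 hft.2).ne', ← g5 t ht, ← h3]
    · congr 1
      push_cast
      rw [pow_succ]
      field_simp
      ring
    · have he' : (Xdig x (n + 1) : ℝ) = 0 ∨ (Xdig x (n + 1) : ℝ) = 1 := by exact_mod_cast he
      rcases he' with h | h <;> rw [h] <;> constructor <;> linarith [ht.1, ht.2]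

theorem PhiM_sub {M : Matrix (Fin 2) (Fin 2) ℝ} {y z : ℝ} (hy : M 1 0 * y + M 1 1 ≠ 0)
    (hz : M 1 0 * z + M 1 1 ≠ 0) :
    PhiM M y - PhiM M z = M.det * (y - z) / ((M 1 0 * y + M 1 1) * (M 1 0 * z + M 1 1)) := by
  rw [PhiM, PhiM, Matrix.det_fin_two, div_sub_div _ _ hy hz]
  congr 1
  ring

/-- The relative length of the left part `[Φ(M; 0), Φ(M; 1/γ)]` of `[Φ(M; 0), Φ(M; 1)]`. -/
theorem PhiM_left_ratio {M : Matrix (Fin 2) (Fin 2) ℝ} {γ : ℝ} (hs : 0 < M 1 1)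
    (hrs : 0 < M 1 0 + M 1 1) (hγ : 1 < γ) :
    PhiM M (1 / γ) - PhiM M 0 = (M 1 0 / M 1 1 + 1) / (M 1 0 / M 1 1 + γ) *
      (PhiM M 1 - PhiM M 0) := by
  have hγ0 : 0 < γ := by linarith
  have h1 : 0 < M 1 0 * (1 / γ) + M 1 1 :=
    denom_pos hs hrs (by positivity) (by rw [div_le_one hγ0]; exact hγ.le)
  have h2 : 0 < M 1 0 + M 1 1 * γ := by nlinarith
  have h3 : M 1 0 * (1 / γ) + M 1 1 = (M 1 0 + M 1 1 * γ) / γ := by field_simp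
  have h4 : M 1 0 / M 1 1 + γ = (M 1 0 + M 1 1 * γ) / M 1 1 := by field_simp
  rw [PhiM_sub h1.ne' (by simpa using hs.ne'), PhiM_sub (by simpa using hrs.ne')
    (by simpa using hs.ne'), h3, h4]
  field_simp
  ring

theorem stmt9
    (a0 b0 c0 d0 a1 b1 c1 d1 : ℝ)
    (hb0 : b0 = 0)
    (hA1a : 0 < (a0 + b0) / (c0 + d0))
    (hA1b : (a0 + b0) / (c0 + d0) = b1 / d1)
    (hA1c : b1 / d1 < (a1 + b1) / (c1 + d1))
    (hA1d : (a1 + b1) / (c1 + d1) = 1)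
    (hA20 : 0 < a0 * d0 - b0 * c0)
    (hA21 : 0 < a1 * d1 - b1 * c1)
    (hA30 : Real.sqrt (a0 * d0 - b0 * c0) < min d0 (c0 + d0))
    (hA31 : Real.sqrt (a1 * d1 - b1 * c1) < min d1 (c1 + d1))
    (f : ℝ → ℝ)
    (hfc : ContinuousOn f (Set.Icc 0 1))
    (hfm : StrictMonoOn f (Set.Icc 0 1))
    (hf0 : f 0 = 0) (hf1 : f 1 = 1)
    (hdR0 : ∀ x ∈ Set.Icc (0 : ℝ) (1 / 2), f x = Phi a0 b0 c0 d0 (f (2 * x)))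
    (hdR1 : ∀ x ∈ Set.Icc (1 / 2 : ℝ) 1, f x = Phi a1 b1 c1 d1 (f (2 * x - 1)))
    (μf : Measure ℝ) [IsProbabilityMeasure μf]
    (hμf : ∀ x ∈ Set.Icc (0 : ℝ) 1, μf (Set.Iic x) = ENNReal.ofReal (f x))
    (γ : ℝ) (hγ : γ = 1 / Phi a0 b0 c0 d0 1)
    (A : ℕ → Matrix (Fin 2) (Fin 2) ℝ)
    (hAm0 : A 0 = !![a0, b0; c0, d0])
    (hAm1 : A 1 = !![a1, b1; c1, d1])
    :
    ∀ n : ℕ, 1 ≤ n →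
      μf[(fun y => -Real.log (Rfun μf y (n + 1) / Rfun μf y n)) | Fcal n]
        =ᵐ[μf]
      (fun x => entS ((matProd A x n 1 0 / matProd A x n 1 1 + 1) / (matProd A x n 1 0 / matProd A x n 1 1 + γ))) := by
  have hd0 : 0 < d0 := (Real.sqrt_nonneg _).trans_lt (hA30.trans_le (min_le_left _ _))
  have hcd0 : 0 < c0 + d0 := (Real.sqrt_nonneg _).trans_lt (hA30.trans_le (min_le_right _ _))
  have hd1 : 0 < d1 := (Real.sqrt_nonneg _).trans_lt (hA31.trans_le (min_le_left _ _))
  have hcd1 : 0 < c1 + d1 := (Real.sqrt_nonneg _).trans_lt (hA31.trans_le (min_le_right _ _))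
  have hγ' : γ = 1 / ((a0 + b0) / (c0 + d0)) := by rw [hγ, Phi, mul_one, mul_one]
  have hlt1 : (a0 + b0) / (c0 + d0) < 1 := by rw [hA1b, ← hA1d]; exact hA1c
  have hγ1 : 1 < γ := by rw [hγ', lt_div_iff₀ hA1a, one_mul]; exact hlt1
  have hfhalf : f (1 / 2) = 1 / γ := by
    rw [hdR0 (1 / 2) ⟨by norm_num, le_rfl⟩, hγ]
    norm_num [hf1]
  have hf : ∀ t ∈ Set.Icc (0 : ℝ) 1, f t ∈ Set.Icc (0 : ℝ) 1 := fun t ht =>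
    ⟨hf0 ▸ hfm.monotoneOn ⟨le_rfl, zero_le_one⟩ ht ht.1,
      hf1 ▸ hfm.monotoneOn ht ⟨zero_le_one, le_rfl⟩ ht.2⟩
  have hd : ∀ e : ℕ, e = 0 ∨ e = 1 → 0 < A e 1 1 ∧ 0 < A e 1 0 + A e 1 1 ∧
      PhiM (A e) 0 ∈ Set.Icc (0 : ℝ) 1 ∧ PhiM (A e) 1 ∈ Set.Icc (0 : ℝ) 1 ∧
      ∀ t ∈ Set.Icc (0 : ℝ) 1, f ((e + t) / 2) = PhiM (A e) (f t) := by
    rintro e (rfl | rfl)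
    · simp only [hAm0, PhiM, Matrix.of_apply, Matrix.cons_val',
        Matrix.cons_val_zero, Matrix.cons_val_one, Matrix.cons_val_fin_one, mul_zero, zero_add, mul_one]
      refine ⟨hd0, hcd0, by simp [hb0], ⟨hA1a.le, hlt1.le⟩, fun t ht => ?_⟩
      rw [Nat.cast_zero, zero_add, hdR0 _ ⟨by linarith [ht.1], by linarith [ht.2]⟩, Phi,
        mul_div_cancel₀ t two_ne_zero]
    · simp only [hAm1, PhiM, Matrix.of_apply, Matrix.cons_val',
        Matrix.cons_val_zero, Matrix.cons_val_one, Matrix.cons_val_fin_one, mul_zero, zero_add, mul_one]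
      refine ⟨hd1, hcd1, hA1b ▸ ⟨hA1a.le, hlt1.le⟩, by simp [hA1d], fun t ht => ?_⟩
      rw [Nat.cast_one, hdR1 _ ⟨by linarith [ht.1], by linarith [ht.2]⟩, Phi,
        mul_div_cancel₀ _ two_ne_zero, add_sub_cancel_left]
  have hμ : ∀ᵐ x ∂μf, x ∈ Set.Ico (0 : ℝ) 1 := by
    have h1 : μf (Set.Ico 0 1) = 1 := by
      rw [measure_Ico_of_cdf hfc hfm hf0 hμf le_rfl zero_le_one le_rfl, hf0, hf1, sub_zero,
        ENNReal.ofReal_one]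
    exact (prob_compl_eq_zero_iff measurableSet_Ico).2 h1
  classical
  intro n hn
  set h : ℝ → ℝ := fun y => -Real.log (Rfun μf y (n + 1) / Rfun μf y n) with hh
  set g : ℝ → ℝ := fun x => entS ((matProd A x n 1 0 / matProd A x n 1 1 + 1) /
    (matProd A x n 1 0 / matProd A x n 1 1 + γ)) with hg
  have hhc : ∀ x y : ℝ, ⌊(2 : ℝ) ^ (n + 1) * x⌋₊ = ⌊(2 : ℝ) ^ (n + 1) * y⌋₊ → h x = h y :=
    fun x y hxy => by
      simp only [hh, Rfun_congr μf le_rfl hxy, Rfun_congr μf (Nat.le_succ n) hxy]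
  have hgc : ∀ x y : ℝ, ⌊(2 : ℝ) ^ n * x⌋₊ = ⌊(2 : ℝ) ^ n * y⌋₊ → g x = g y :=
    fun x y hxy => by simp only [hg, matProd_congr A hxy]
  have hh_int : Integrable h μf :=
    (integral_of_dyadic_const μf hμ (n + 1) h fun x _ y _ => hhc x y).1
  have hg_int : Integrable g μf :=
    (integral_of_dyadic_const μf hμ n g fun x _ y _ => hgc x y).1
  have hg_meas : Measurable[Fcal n] g := by
    have hq := (measurable_matProd_Fcal A (le_refl n) 1 0).div
      (measurable_matProd_Fcal A (le_refl n) 1 1)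
    exact measurable_entS.comp ((hq.add_const 1).div (hq.add_const γ))
  symm
  refine ae_eq_condExp_of_forall_setIntegral_eq (Fcal_le_borel n) hh_int
    (fun S _ _ => hg_int.integrableOn) (fun S hS _ => ?_)
    hg_meas.stronglyMeasurable.aestronglyMeasurable
  have hS' := Fcal_le_borel n S hS
  have hSc : ∀ x y : ℝ, ⌊(2 : ℝ) ^ n * x⌋₊ = ⌊(2 : ℝ) ^ n * y⌋₊ → (x ∈ S ↔ y ∈ S) :=
    fun x y => Fcal_mem_congr hS
  rw [← integral_indicator hS', ← integral_indicator hS',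
    (integral_of_dyadic_const μf hμ n (S.indicator g) fun x _ y _ hxy => by
      simp only [Set.indicator_apply, hSc x y hxy, hgc x y hxy]).2,
    (integral_of_dyadic_const μf hμ (n + 1) (S.indicator h) fun x _ y _ hxy => by
      simp only [Set.indicator_apply, hSc x y (floor_two_pow_mul_congr (Nat.le_succ n) hxy),
        hhc x y hxy]).2,
    pow_succ' 2 n, sum_range_two_mul_s9]
  refine Finset.sum_congr rfl fun j hj => ?_
  have hj := Finset.mem_range.1 hj
  have hj0 : 2 * j < 2 ^ (n + 1) := by rw [pow_succ]; omega
  have hj1 : 2 * j + 1 < 2 ^ (n + 1) := by rw [pow_succ]; omega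
  have hfl : ⌊(2 : ℝ) ^ n * ((j : ℝ) / 2 ^ n)⌋₊ = j := floor_dyadic n j
  have hfl0 : ⌊(2 : ℝ) ^ n * (((2 * j : ℕ) : ℝ) / 2 ^ (n + 1))⌋₊ = j := by
    rw [floor_two_pow_mul_of_le (Nat.le_succ n), floor_dyadic, Nat.succ_sub (le_refl n)]
    simp
  have hfl1 : ⌊(2 : ℝ) ^ n * (((2 * j + 1 : ℕ) : ℝ) / 2 ^ (n + 1))⌋₊ = j := by
    rw [floor_two_pow_mul_of_le (Nat.le_succ n), floor_dyadic, Nat.succ_sub (le_refl n)]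
    simp
    omega
  obtain ⟨hs, hrs, hM⟩ := deRham_iterate A f hf hd (dyadic_mem_Ico hj) n
  have hm := toReal_measure_dyadic_of_cdf hfc hfm hf0 hμf hj
  have hm0 := toReal_measure_dyadic_of_cdf hfc hfm hf0 hμf hj0
  have hm1 := toReal_measure_dyadic_of_cdf hfc hfm hf0 hμf hj1
  have hn0 : n ≠ 0 := by omega
  have hR : ∀ x, ⌊(2 : ℝ) ^ n * x⌋₊ = j → Rfun μf x n =
      (μf (Set.Ico ((j : ℝ) / 2 ^ n) (((j : ℝ) + 1) / 2 ^ n))).toReal := fun x hx => by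
    rw [Rfun, if_neg hn0, dyadI, hx]
  have hR' : ∀ k : ℕ, Rfun μf ((k : ℝ) / 2 ^ (n + 1)) (n + 1) =
      (μf (Set.Ico ((k : ℝ) / 2 ^ (n + 1)) (((k : ℝ) + 1) / 2 ^ (n + 1)))).toReal := fun k => by
    rw [Rfun, if_neg n.succ_ne_zero, dyadI, floor_dyadic]
  have hM0 := hM 0 ⟨le_rfl, zero_le_one⟩
  have hM1 := hM 1 ⟨zero_le_one, le_rfl⟩
  have hMh := hM (1 / 2) ⟨by norm_num, by norm_num⟩
  have hrat := PhiM_left_ratio hs hrs hγ1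
  rw [hfl, hf0, add_zero] at hM0
  rw [hfl, hf1] at hM1
  rw [hfl, hfhalf] at hMh
  rw [← hM0, ← hM1, ← hMh] at hrat
  set p := (matProd A ((j : ℝ) / 2 ^ n) n 1 0 / matProd A ((j : ℝ) / 2 ^ n) n 1 1 + 1) /
    (matProd A ((j : ℝ) / 2 ^ n) n 1 0 / matProd A ((j : ℝ) / 2 ^ n) n 1 1 + γ)
  have hρ : 0 < f (((j : ℝ) + 1) / 2 ^ n) - f ((j : ℝ) / 2 ^ n) := by
    have h2 : (0 : ℝ) < 2 ^ n := by positivity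
    have hmem := dyadic_mem_Ico hj
    have hlt : (j : ℝ) / 2 ^ n < ((j : ℝ) + 1) / 2 ^ n := by gcongr; linarith
    refine sub_pos.2 (hfm ⟨hmem.1, hmem.2.le⟩ ⟨hmem.1.trans hlt.le, ?_⟩ hlt)
    rw [div_le_one h2]
    exact_mod_cast hj
  have e0 : ((2 * j : ℕ) : ℝ) / 2 ^ (n + 1) = (j : ℝ) / 2 ^ n := by
    push_cast; rw [pow_succ]; field_simp
  have e1 : (((2 * j : ℕ) : ℝ) + 1) / 2 ^ (n + 1) = ((j : ℝ) + 1 / 2) / 2 ^ n := by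
    push_cast; rw [pow_succ]; field_simp
  have e2 : ((2 * j + 1 : ℕ) : ℝ) / 2 ^ (n + 1) = ((j : ℝ) + 1 / 2) / 2 ^ n := by
    push_cast; rw [pow_succ]; field_simp
  have e3 : (((2 * j + 1 : ℕ) : ℝ) + 1) / 2 ^ (n + 1) = ((j : ℝ) + 1) / 2 ^ n := by
    push_cast; rw [pow_succ]; field_simp; ring
  set ρ := f (((j : ℝ) + 1) / 2 ^ n) - f ((j : ℝ) / 2 ^ n)
  have hm0' := hm0.trans (show _ = p * ρ by rw [e0, e1, hrat])
  have hm1' := hm1.trans (show _ = (1 - p) * ρ by rw [e2, e3, sub_mul, ← hrat]; ring)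
  have hh0 : h (((2 * j : ℕ) : ℝ) / 2 ^ (n + 1)) = -Real.log p := by
    simp only [hh]
    rw [hR', hm0', hR _ hfl0, hm, mul_div_cancel_right₀ _ hρ.ne']
  have hh1 : h (((2 * j + 1 : ℕ) : ℝ) / 2 ^ (n + 1)) = -Real.log (1 - p) := by
    simp only [hh]
    rw [hR', hm1', hR _ hfl1, hm, mul_div_cancel_right₀ _ hρ.ne']
  have hgj : g ((j : ℝ) / 2 ^ n) = entS p := rfl
  rw [hm, hm0', hm1']
  simp only [Set.indicator_apply, hSc _ _ (hfl0.trans hfl.symm), hSc _ _ (hfl1.trans hfl.symm),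
    hh0, hh1, hgj]
  split_ifs
  · rw [entS]
    ring
  · ring
end
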